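/- arXiv:2605.09482 — 2 statements merged into one kernel-verified Lean document; each statement's English description precedes it below -/
import Mathlib

section
/- Let σ and μ be positive semidefinite symmetric bilinear forms on a real vector space V. Then for all a,b ∈ V, σ(a,a)μ(b,b) + μ(a,a)σ(b,b) − 2σ(a,b)μ(a,b) ≥ 0; equivalently, the Kulkarni–Nomizu 4-bracket satisfies R(a,b,a,b) ≥ 0. -/
theorem psd_cauchy_schwarz {V : Type*} [AddCommGroup V] [Module ℝ V]
    (σ : V →ₗ[ℝ] V →ₗ[ℝ] ℝ) (hσ : ∀ x y : V, σ x y = σ y x)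
    (hpos : ∀ v : V, 0 ≤ σ v v) (a b : V) : (σ a b) ^ 2 ≤ σ a a * σ b b := by
  have h : ∀ x : ℝ, 0 ≤ σ a a * (x * x) + (2 * σ a b) * x + σ b b := by
    intro x
    have h1 := hpos (x • a + b)
    simp only [map_add, map_smul, LinearMap.add_apply, LinearMap.smul_apply, smul_eq_mul,
      hσ b a] at h1
    linarith
  have h2 := discrim_le_zero h
  unfold discrim at h2
  linarith

/-- For positive semidefinite symmetric bilinear forms σ and μ on a real vector
space, σ(a,a)μ(b,b) + μ(a,a)σ(b,b) − 2σ(a,b)μ(a,b) ≥ 0; equivalently, the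
Kulkarni–Nomizu 4-bracket satisfies R(a,b,a,b) ≥ 0. -/
theorem kulkarni_nomizu_diag_nonneg (V : Type*) [AddCommGroup V] [Module ℝ V]
    (σ μ : V →ₗ[ℝ] V →ₗ[ℝ] ℝ)
    (hσ : ∀ x y : V, σ x y = σ y x) (hμ : ∀ x y : V, μ x y = μ y x)
    (hσpos : ∀ v : V, 0 ≤ σ v v) (hμpos : ∀ v : V, 0 ≤ μ v v)
    (R : V → V → V → V → ℝ)
    (hR : ∀ a b c d : V, R a b c d =
      σ a c * μ b d - σ a d * μ b c + μ a c * σ b d - μ a d * σ b c) :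
    ∀ a b : V,
      0 ≤ σ a a * μ b b + μ a a * σ b b - 2 * σ a b * μ a b ∧
      0 ≤ R a b a b := by
  intro a b
  have h1 := psd_cauchy_schwarz σ hσ hσpos a b
  have h2 := psd_cauchy_schwarz μ hμ hμpos a b
  have key : 0 ≤ σ a a * μ b b + μ a a * σ b b - 2 * σ a b * μ a b := by
    have hp : 0 ≤ σ a a * μ b b := mul_nonneg (hσpos a) (hμpos b)
    have hq : 0 ≤ μ a a * σ b b := mul_nonneg (hμpos a) (hσpos b)
    have h3 : (σ a b) ^ 2 * (μ a b) ^ 2 ≤ (σ a a * σ b b) * (μ a a * μ b b) :=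
      mul_le_mul h1 h2 (sq_nonneg _) (le_trans (sq_nonneg _) h1)
    have h4 : (2 * σ a b * μ a b) ^ 2 ≤ (σ a a * μ b b + μ a a * σ b b) ^ 2 := by
      nlinarith [sq_nonneg (σ a a * μ b b - μ a a * σ b b)]
    have h5 := le_of_abs_le (abs_le_of_sq_le_sq h4 (add_nonneg hp hq))
    linarith
  refine ⟨key, ?_⟩
  rw [hR, hσ b a, hμ b a]
  linarith
end

section
/- Let J : ℝ^m → (antisymmetric m×m real matrices), σ, μ : ℝ^m → (positive semidefinite symmetric m×m real matrices) be smooth fields, let H, S : ℝ^m → ℝ be smooth, and suppose S is a Casimir, i.e., J(x)∇S(x) = 0 for all x. Define the 4-tensor R^{ijkl}(x) = σ^{ik}μ^{jl} − σ^{il}μ^{jk} + μ^{ik}σ^{jl} − μ^{il}σ^{jk} and the metriplectic vector field X^i(x) = Σ_j J^{ij}(x)∂_jH(x) + Σ_{jkl} R^{ijkl}(x)∂_jH(x)∂_kS(x)∂_lH(x). Then along any differentiable solution x(t) of ẋ = X(x): (d/dt)H(x(t)) = 0 and (d/dt)S(x(t)) ≥ 0 for all t. -/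
open scoped BigOperators

/-- The i-th partial derivative of a function on ℝ^m. -/
noncomputable def partialDeriv4 (m : ℕ) (f : (Fin m → ℝ) → ℝ) (x : Fin m → ℝ)
    (i : Fin m) : ℝ :=
  fderiv ℝ f x (Pi.single i 1)

/-- The Kulkarni–Nomizu 4-tensor R^{ijkl} = σ^{ik}μ^{jl} − σ^{il}μ^{jk} + μ^{ik}σ^{jl}
− μ^{il}σ^{jk} of two matrix fields. -/
noncomputable def knTensor4 (m : ℕ) (σ μ : (Fin m → ℝ) → Matrix (Fin m) (Fin m) ℝ)
    (x : Fin m → ℝ) (i j k l : Fin m) : ℝ :=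
  σ x i k * μ x j l - σ x i l * μ x j k + μ x i k * σ x j l - μ x i l * σ x j k

/-- The metriplectic vector field
X^i = Σ_j J^{ij} ∂_jH + Σ_{jkl} R^{ijkl} ∂_jH ∂_kS ∂_lH. -/
noncomputable def metriplecticField4 (m : ℕ)
    (J σ μ : (Fin m → ℝ) → Matrix (Fin m) (Fin m) ℝ)
    (H S : (Fin m → ℝ) → ℝ) (x : Fin m → ℝ) (i : Fin m) : ℝ :=
  (∑ j, J x i j * partialDeriv4 m H x j)
    + ∑ j, ∑ k, ∑ l, knTensor4 m σ μ x i j k l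
        * partialDeriv4 m H x j * partialDeriv4 m S x k * partialDeriv4 m H x l

/-- Bilinear form of a matrix. -/
noncomputable def bil4 {m : ℕ} (M : Matrix (Fin m) (Fin m) ℝ) (v w : Fin m → ℝ) : ℝ :=
  ∑ i, ∑ j, v i * M i j * w j

theorem bil4_comb {m : ℕ} (M : Matrix (Fin m) (Fin m) ℝ) (v w : Fin m → ℝ) (c d : ℝ) :
    bil4 M (fun i => c * v i + d * w i) (fun i => c * v i + d * w i)
      = c * c * bil4 M v v + c * d * bil4 M v w + c * d * bil4 M w v + d * d * bil4 M w w := by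
  simp only [bil4, Finset.mul_sum, ← Finset.sum_add_distrib]
  refine Finset.sum_congr rfl fun i _ => Finset.sum_congr rfl fun j _ => ?_
  ring

theorem bil4_symm {m : ℕ} (M : Matrix (Fin m) (Fin m) ℝ) (hM : ∀ i j, M i j = M j i)
    (v w : Fin m → ℝ) : bil4 M v w = bil4 M w v := by
  unfold bil4
  rw [Finset.sum_comm]
  refine Finset.sum_congr rfl fun i _ => Finset.sum_congr rfl fun j _ => ?_
  rw [hM j i]; ring

theorem bil4_cs {m : ℕ} (M : Matrix (Fin m) (Fin m) ℝ) (hM : ∀ i j, M i j = M j i)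
    (hp : ∀ v, 0 ≤ bil4 M v v) (v w : Fin m → ℝ) :
    bil4 M v w ^ 2 ≤ bil4 M v v * bil4 M w w := by
  have h : ∀ t : ℝ, 0 ≤ bil4 M v v * (t * t) + (2 * bil4 M v w) * t + bil4 M w w := by
    intro t
    have h1 := hp (fun i => t * v i + 1 * w i)
    rw [bil4_comb, bil4_symm M hM w v] at h1
    linarith
  have h2 := discrim_le_zero h
  unfold discrim at h2
  linarith

theorem bil4_mul {m : ℕ} (M N : Matrix (Fin m) (Fin m) ℝ) (a b c d : Fin m → ℝ) :
    bil4 M a b * bil4 N c d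
      = ∑ i, ∑ j, ∑ k, ∑ l, a i * M i k * b k * (c j * N j l * d l) := by
  unfold bil4
  rw [Finset.sum_mul_sum]
  refine Finset.sum_congr rfl fun i _ => Finset.sum_congr rfl fun j _ => ?_
  rw [Finset.sum_mul_sum]

theorem bil4_mul' {m : ℕ} (M N : Matrix (Fin m) (Fin m) ℝ) (a b c d : Fin m → ℝ) :
    bil4 M a b * bil4 N c d
      = ∑ i, ∑ j, ∑ k, ∑ l, a i * M i l * b l * (c j * N j k * d k) := by
  rw [bil4_mul]
  refine Finset.sum_congr rfl fun i _ => Finset.sum_congr rfl fun j _ => ?_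
  rw [Finset.sum_comm]

theorem kn_contract4 (m : ℕ) (σ μ : (Fin m → ℝ) → Matrix (Fin m) (Fin m) ℝ)
    (x a h s : Fin m → ℝ) :
    ∑ i, a i * ∑ j, ∑ k, ∑ l, knTensor4 m σ μ x i j k l * h j * s k * h l
      = bil4 (σ x) a s * bil4 (μ x) h h - bil4 (σ x) a h * bil4 (μ x) h s
        + bil4 (μ x) a s * bil4 (σ x) h h - bil4 (μ x) a h * bil4 (σ x) h s := by
  rw [bil4_mul (σ x), bil4_mul (μ x), bil4_mul' (σ x), bil4_mul' (μ x)]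
  simp only [Finset.mul_sum, ← Finset.sum_add_distrib, ← Finset.sum_sub_distrib]
  refine Finset.sum_congr rfl fun i _ => Finset.sum_congr rfl fun j _ =>
    Finset.sum_congr rfl fun k _ => Finset.sum_congr rfl fun l _ => ?_
  unfold knTensor4
  ring

theorem real_ineq4 (p q r P Q R : ℝ) (hp : 0 ≤ p) (hr : 0 ≤ r) (hP : 0 ≤ P) (hR : 0 ≤ R)
    (h1 : q ^ 2 ≤ p * r) (h2 : Q ^ 2 ≤ P * R) : 0 ≤ p * R - q * Q + P * r - Q * q := by
  have h3 : q ^ 2 * Q ^ 2 ≤ (p * r) * (P * R) :=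
    mul_le_mul h1 h2 (sq_nonneg _) (mul_nonneg hp hr)
  have h4 : 0 ≤ p * R + P * r := by positivity
  have h5 : 2 * (q * Q) ≤ p * R + P * r := by
    apply le_of_sq_le_sq _ h4
    nlinarith [sq_nonneg (p * R - P * r)]
  linarith

theorem chain4 (m : ℕ) (f : (Fin m → ℝ) → ℝ) (hf : ContDiff ℝ (⊤ : ℕ∞) f)
    (x : ℝ → Fin m → ℝ) (t : ℝ) (X : Fin m → ℝ)
    (hx : ∀ i, HasDerivAt (fun s => x s i) (X i) t) :
    deriv (fun s => f (x s)) t = ∑ i, partialDeriv4 m f (x t) i * X i := by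
  have hd : HasDerivAt x X t := hasDerivAt_pi.2 hx
  have hfd : HasFDerivAt f (fderiv ℝ f (x t)) (x t) :=
    (hf.differentiable (by simp) (x t)).hasFDerivAt
  have h := (hfd.comp_hasDerivAt t hd).deriv
  have h' : deriv (fun s => f (x s)) t = fderiv ℝ f (x t) X := h
  rw [h']
  conv_lhs => rw [pi_eq_sum_univ' X]
  simp only [map_sum, map_smul, smul_eq_mul, partialDeriv4]
  refine Finset.sum_congr rfl fun i _ => ?_
  rw [mul_comm]

/-- Thermodynamic consistency of metriplectic dynamical systems on ℝ^m built from an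
antisymmetric Poisson tensor field J, positive semidefinite symmetric fields σ and μ,
a Hamiltonian H, and an entropy S that is a Casimir of J: along any differentiable
solution, Ḣ = 0 and Ṡ ≥ 0. -/
theorem metriplectic_thermodynamic_consistency (m : ℕ)
    (J σ μ : (Fin m → ℝ) → Matrix (Fin m) (Fin m) ℝ)
    (hJsmooth : ∀ i j, ContDiff ℝ (⊤ : ℕ∞) (fun x => J x i j))
    (hσsmooth : ∀ i j, ContDiff ℝ (⊤ : ℕ∞) (fun x => σ x i j))
    (hμsmooth : ∀ i j, ContDiff ℝ (⊤ : ℕ∞) (fun x => μ x i j))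
    (hJanti : ∀ x i j, J x i j = -J x j i)
    (hσsymm : ∀ x i j, σ x i j = σ x j i)
    (hμsymm : ∀ x i j, μ x i j = μ x j i)
    (hσpos : ∀ (x : Fin m → ℝ) (v : Fin m → ℝ), 0 ≤ ∑ i, ∑ j, v i * σ x i j * v j)
    (hμpos : ∀ (x : Fin m → ℝ) (v : Fin m → ℝ), 0 ≤ ∑ i, ∑ j, v i * μ x i j * v j)
    (H S : (Fin m → ℝ) → ℝ)
    (hH : ContDiff ℝ (⊤ : ℕ∞) H) (hS : ContDiff ℝ (⊤ : ℕ∞) S)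
    (hCasimir : ∀ x i, ∑ j, J x i j * partialDeriv4 m S x j = 0)
    (x : ℝ → Fin m → ℝ)
    (hsol : ∀ t i, HasDerivAt (fun s => x s i)
      (metriplecticField4 m J σ μ H S (x t) i) t) :
    (∀ t, deriv (fun s => H (x s)) t = 0) ∧ ∀ t, 0 ≤ deriv (fun s => S (x s)) t := by
  have hJ : ∀ y a, ∑ i, a i * ∑ j, J y i j * partialDeriv4 m H y j
      = bil4 (J y) a (partialDeriv4 m H y) := by
    intro y a
    simp only [bil4, Finset.mul_sum, mul_assoc]
  have hanti : ∀ y v w, bil4 (J y) v w = - bil4 (J y) w v := by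
    intro y v w
    unfold bil4
    rw [Finset.sum_comm, ← Finset.sum_neg_distrib]
    refine Finset.sum_congr rfl fun i _ => ?_
    rw [← Finset.sum_neg_distrib]
    refine Finset.sum_congr rfl fun j _ => ?_
    rw [hJanti y j i]; ring
  have hcas : ∀ y v, bil4 (J y) v (partialDeriv4 m S y) = 0 := by
    intro y v
    simp only [bil4, mul_assoc, ← Finset.mul_sum, hCasimir, mul_zero, Finset.sum_const_zero]
  refine ⟨fun t => ?_, fun t => ?_⟩
  · rw [chain4 m H hH x t _ (hsol t)]
    simp only [metriplecticField4, mul_add, Finset.sum_add_distrib]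
    rw [hJ, kn_contract4]
    have := hanti (x t) (partialDeriv4 m H (x t)) (partialDeriv4 m H (x t))
    linarith
  · rw [chain4 m S hS x t _ (hsol t)]
    simp only [metriplecticField4, mul_add, Finset.sum_add_distrib]
    rw [hJ, kn_contract4, hanti, hcas, neg_zero, zero_add,
      bil4_symm (μ (x t)) (hμsymm _) (partialDeriv4 m H (x t)) (partialDeriv4 m S (x t)),
      bil4_symm (σ (x t)) (hσsymm _) (partialDeriv4 m H (x t)) (partialDeriv4 m S (x t))]
    exact real_ineq4 _ _ _ _ _ _ (hσpos _ _) (hσpos _ _) (hμpos _ _) (hμpos _ _)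
      (bil4_cs _ (hσsymm _) (hσpos _) _ _) (bil4_cs _ (hμsymm _) (hμpos _) _ _)
end
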